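/- The four-form Φ₀ = dx₁₂₃₄ − dx₁₂₅₆ − dx₁₂₇₈ − dx₁₃₅₇ + dx₁₃₆₈ − dx₁₄₅₈ − dx₁₄₆₇ − dx₂₃₅₈ − dx₂₃₆₇ + dx₂₄₅₇ − dx₂₄₆₈ − dx₃₄₅₆ − dx₃₄₇₈ + dx₅₆₇₈ on ℝ⁸ has comass 1: for every orthonormal set of vectors v₁, v₂, v₃, v₄ in ℝ⁸, |Φ₀(v₁,v₂,v₃,v₄)| ≤ 1, and equality is attained for some orthonormal 4-tuple (e.g. the standard vectors e₁,e₂,e₃,e₄). -/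

import Mathlib

/- STATEMENT 1: the Cayley four-form Φ₀ on ℝ⁸ has comass 1. -/

/-- `dx_{ijkl}` applied to four vectors of ℝ⁸: the determinant of the 4×4 minor of
components i,j,k,l. -/
noncomputable def dx4 (i j k l : Fin 8) (v : Fin 4 → EuclideanSpace ℝ (Fin 8)) : ℝ :=
  Matrix.det (Matrix.of fun a b => v a (![i, j, k, l] b))

/-- The Cayley form Φ₀ = dx₁₂₃₄ − dx₁₂₅₆ − dx₁₂₇₈ − dx₁₃₅₇ + dx₁₃₆₈ − dx₁₄₅₈ − dx₁₄₆₇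
− dx₂₃₅₈ − dx₂₃₆₇ + dx₂₄₅₇ − dx₂₄₆₈ − dx₃₄₅₆ − dx₃₄₇₈ + dx₅₆₇₈
(indices shifted to 0,…,7), evaluated on four vectors. -/
noncomputable def Phi0 (v : Fin 4 → EuclideanSpace ℝ (Fin 8)) : ℝ :=
  dx4 0 1 2 3 v - dx4 0 1 4 5 v - dx4 0 1 6 7 v - dx4 0 2 4 6 v + dx4 0 2 5 7 v
    - dx4 0 3 4 7 v - dx4 0 3 5 6 v - dx4 1 2 4 7 v - dx4 1 2 5 6 v + dx4 1 3 4 6 v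
    - dx4 1 3 5 7 v - dx4 2 3 4 5 v - dx4 2 3 6 7 v + dx4 4 5 6 7 v

/-- The components of `x ∧ y` along the seven two-forms `ω` with `∑ ω ∧ ω = 6 Φ₀`; up to
scale, this is the projection of `x ∧ y` to the seven-dimensional summand of `Λ²ℝ⁸` under `Spin(7)`. -/
noncomputable def cayleyTwoForms (x y : EuclideanSpace ℝ (Fin 8)) : EuclideanSpace ℝ (Fin 7) :=
  let p (i j : Fin 8) : ℝ := x i * y j - x j * y i
  !₂[p 0 1 + p 2 3 - p 4 5 - p 6 7,
    p 0 2 - p 1 3 - p 4 6 + p 5 7,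
    p 0 3 + p 1 2 - p 4 7 - p 5 6,
    p 0 4 + p 1 5 + p 2 6 + p 3 7,
    p 0 5 - p 1 4 - p 2 7 + p 3 6,
    p 0 6 + p 1 7 - p 2 4 - p 3 5,
    p 0 7 - p 1 6 + p 2 5 - p 3 4]

lemma dx4_eq (i j k l : Fin 8) (v : Fin 4 → EuclideanSpace ℝ (Fin 8)) :
    dx4 i j k l v =
      (v 0 i * v 1 j - v 0 j * v 1 i) * (v 2 k * v 3 l - v 2 l * v 3 k)
      - (v 0 i * v 1 k - v 0 k * v 1 i) * (v 2 j * v 3 l - v 2 l * v 3 j)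
      + (v 0 i * v 1 l - v 0 l * v 1 i) * (v 2 j * v 3 k - v 2 k * v 3 j)
      + (v 0 j * v 1 k - v 0 k * v 1 j) * (v 2 i * v 3 l - v 2 l * v 3 i)
      - (v 0 j * v 1 l - v 0 l * v 1 j) * (v 2 i * v 3 k - v 2 k * v 3 i)
      + (v 0 k * v 1 l - v 0 l * v 1 k) * (v 2 i * v 3 j - v 2 j * v 3 i) := by
  simp [dx4, Matrix.det_succ_row_zero, Fin.sum_univ_succ, Fin.succAbove]
  ring

open scoped RealInnerProductSpace in
lemma inner_cayleyTwoForms (v : Fin 4 → EuclideanSpace ℝ (Fin 8)) :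
    ⟪cayleyTwoForms (v 0) (v 1), cayleyTwoForms (v 2) (v 3)⟫ =
      Phi0 v + (⟪v 0, v 2⟫ * ⟪v 1, v 3⟫ - ⟪v 0, v 3⟫ * ⟪v 1, v 2⟫) := by
  simp only [Phi0, dx4_eq, cayleyTwoForms, PiLp.inner_apply, RCLike.inner_apply, conj_trivial,
    Fin.sum_univ_seven, Fin.sum_univ_eight]
  simp only [Matrix.cons_val]
  ring

lemma dx4_eq_zero_of_eq (i j k l : Fin 8) {v : Fin 4 → EuclideanSpace ℝ (Fin 8)} {a b : Fin 4}
    (hab : a ≠ b) (h : v a = v b) : dx4 i j k l v = 0 :=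
  Matrix.det_zero_of_row_eq hab (by ext; simp [h])

lemma norm_cayleyTwoForms {x y : EuclideanSpace ℝ (Fin 8)} (hx : ‖x‖ = 1) (hy : ‖y‖ = 1)
    (hxy : inner ℝ x y = 0) : ‖cayleyTwoForms x y‖ = 1 := by
  have hPhi : Phi0 ![x, y, x, y] = 0 := by
    have hdx (i j k l : Fin 8) : dx4 i j k l ![x, y, x, y] = 0 :=
      dx4_eq_zero_of_eq i j k l (a := 0) (b := 2) (by decide) rfl
    simp [Phi0, hdx]
  have h := inner_cayleyTwoForms ![x, y, x, y]
  rw [hPhi] at h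
  simp only [Matrix.cons_val, real_inner_self_eq_norm_sq, hx, hy, hxy] at h
  rw [← sq_eq_sq₀ (norm_nonneg _) zero_le_one, h]
  norm_num

/-- Φ₀ has comass one: |Φ₀(v₁,v₂,v₃,v₄)| ≤ 1 for every orthonormal 4-tuple, with
equality attained (e.g. on the standard vectors e₁,e₂,e₃,e₄). -/
theorem Phi0_comass_one :
    (∀ v : Fin 4 → EuclideanSpace ℝ (Fin 8), Orthonormal ℝ v → |Phi0 v| ≤ 1) ∧
    (∃ v : Fin 4 → EuclideanSpace ℝ (Fin 8), Orthonormal ℝ v ∧ Phi0 v = 1) := by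
  refine ⟨fun v hv => ?_, fun a => EuclideanSpace.basisFun (Fin 8) ℝ (a.castLE (by norm_num)),
    (EuclideanSpace.basisFun (Fin 8) ℝ).orthonormal.comp _ (Fin.castLE_injective (by norm_num)), ?_⟩
  · have h := inner_cayleyTwoForms v
    rw [hv.2 (show (0 : Fin 4) ≠ 2 by decide), hv.2 (show (0 : Fin 4) ≠ 3 by decide)] at h
    have hle := abs_real_inner_le_norm (cayleyTwoForms (v 0) (v 1)) (cayleyTwoForms (v 2) (v 3))
    rw [norm_cayleyTwoForms (hv.1 0) (hv.1 1) (hv.2 (by decide)),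
      norm_cayleyTwoForms (hv.1 2) (hv.1 3) (hv.2 (by decide)), h] at hle
    simpa using hle
  · simp [Phi0, dx4_eq, Fin.ext_iff]
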